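/- arXiv:1804.09240 — 3 statements merged into one kernel-verified Lean document; each statement's English description precedes it below -/
import Mathlib

section
/- Given a 2-connected graph G and an H-model f of G, suppose there exist an edge ab ∈ E(H), a cut vertex x of G(f,a), and a connected component C of G(f,a) ∖ {x} containing at least one vertex with a neighbour in G(f,b), such that f hits neither a leaf-crucial model nor a leaf-b-crucial model on relabeling C. Then f can be reconfigured (by single-vertex relabeling steps, each yielding an H-model) to an H-model g such that g(v) ≠ f(v) for every v ∈ V(C), g(u) = f(u) for all u ∉ V(C), and x has a neighbour in G(g,b). -/
open SimpleGraph

section Defs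

variable {V : Type*} {W : Type*}

/-- `f` is an `H`-model of `G`: every branch set (preimage of a label) is nonempty and
connected, and for every edge of `H` there is a connecting edge of `G`. -/
def IsModel (G : SimpleGraph V) (H : SimpleGraph W) (f : V → W) : Prop :=
  (∀ i : W, (f ⁻¹' {i}).Nonempty ∧ (G.induce (f ⁻¹' {i})).Connected) ∧
  ∀ ⦃i j : W⦄, H.Adj i j → ∃ u v : V, G.Adj u v ∧ f u = i ∧ f v = j

/-- One reconfiguration step: both endpoints are `H`-models and they differ on exactly
one vertex of `G`. -/
def ModelStep (G : SimpleGraph V) (H : SimpleGraph W) (f g : V → W) : Prop :=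
  IsModel G H f ∧ IsModel G H g ∧ ∃ v : V, f v ≠ g v ∧ ∀ u : V, u ≠ v → f u = g u

/-- `G` is in `host(H)`: it admits an `H`-model and the reconfiguration graph of
`H`-models of `G` is connected. -/
def InHost (G : SimpleGraph V) (H : SimpleGraph W) : Prop :=
  (∃ f : V → W, IsModel G H f) ∧
  ∀ f g : V → W, IsModel G H f → IsModel G H g →
    Relation.ReflTransGen (ModelStep G H) f g

/-- `S` is a cut set of `G`: deleting `S` leaves at least two components. -/
def IsCutSet (G : SimpleGraph V) (S : Set V) : Prop :=
  ∃ u w : ↥(Sᶜ), ¬ (G.induce Sᶜ).Reachable u w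

/-- `G` is `k`-connected: it has no cut set of fewer than `k` vertices. -/
def KConnected (G : SimpleGraph V) (k : ℕ) : Prop :=
  ∀ S : Set V, S.Finite → S.ncard < k → ¬ IsCutSet G S

/-- `v` is a cut vertex of the subgraph of `G` induced on `A`. -/
def IsCutVertexOf (G : SimpleGraph V) (A : Set V) (v : V) : Prop :=
  v ∈ A ∧ ∃ u w : ↥(A \ {v}), ¬ (G.induce (A \ {v})).Reachable u w

def NoCutVertexIn (G : SimpleGraph V) (B : Set V) : Prop :=
  ∀ v : V, ¬ IsCutVertexOf G B v

/-- `B` is a block of the subgraph of `G` induced on `A`: a maximal connected subgraph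
of it without a cut vertex. -/
def IsBlockOf (G : SimpleGraph V) (A B : Set V) : Prop :=
  B ⊆ A ∧ B.Nonempty ∧ (G.induce B).Connected ∧ NoCutVertexIn G B ∧
  ∀ B' : Set V, B ⊆ B' → B' ⊆ A → (G.induce B').Connected → NoCutVertexIn G B' → B' = B

/-- `B` is a leaf block of the subgraph of `G` induced on `A`: a block containing at
most one joining vertex (cut vertex of the induced subgraph on `A`). -/
def IsLeafBlockOf (G : SimpleGraph V) (A B : Set V) : Prop :=
  IsBlockOf G A B ∧
  ∀ v w : V, v ∈ B → w ∈ B → IsCutVertexOf G A v → IsCutVertexOf G A w → v = w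

/-- `v` is essential for label `b`: `f v` and `b` are adjacent labels of `H` and every
connecting edge between the branch sets of `f v` and of `b` has `v` as an endpoint. -/
def EssentialFor (G : SimpleGraph V) (H : SimpleGraph W) (f : V → W) (v : V) (b : W) : Prop :=
  H.Adj (f v) b ∧ ∀ u w : V, G.Adj u w → f u = f v → f w = b → u = v

/-- `v` is crucial: essential for two distinct labels. -/
def IsCrucial (G : SimpleGraph V) (H : SimpleGraph W) (f : V → W) (v : V) : Prop :=
  ∃ b c : W, b ≠ c ∧ EssentialFor G H f v b ∧ EssentialFor G H f v c

/-- `v` is `b`-crucial: `v` has a neighbour labeled `b` and is essential for some label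
`c ∉ {f v, b}`. -/
def IsBCrucial (G : SimpleGraph V) (H : SimpleGraph W) (f : V → W) (v : V) (b : W) : Prop :=
  (∃ u : V, G.Adj v u ∧ f u = b) ∧
  ∃ c : W, c ≠ f v ∧ c ≠ b ∧ EssentialFor G H f v c

/-- `uv` is the unique (essential) connecting edge between branch sets `a` and `b`. -/
def IsEssEdge (G : SimpleGraph V) (f : V → W) (a b : W) (u v : V) : Prop :=
  G.Adj u v ∧ f u = a ∧ f v = b ∧
  ∀ u' v' : V, G.Adj u' v' → f u' = a → f v' = b → u' = u ∧ v' = v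

/-- The branch sets of labels `a` and `b` are weakly connected. -/
def WeaklyConnected (G : SimpleGraph V) (H : SimpleGraph W) (f : V → W) (a b : W) : Prop :=
  (∃ v : V, f v = a ∧ EssentialFor G H f v b) ∨
  (∃ v : V, f v = b ∧ EssentialFor G H f v a)

/-- `p` is a valid designation of a lynchpin for the weak connection between the branch
sets of `a` and `b`: an endpoint of the essential edge if one exists, and otherwise the
essential vertex giving rise to the weak connection. -/
def IsLynchpin (G : SimpleGraph V) (H : SimpleGraph W) (f : V → W) (a b : W) (p : V) : Prop :=
  (∃ u v : V, IsEssEdge G f a b u v ∧ (p = u ∨ p = v)) ∨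
  ((∀ u v : V, ¬ IsEssEdge G f a b u v) ∧
    ((f p = a ∧ EssentialFor G H f p b) ∨ (f p = b ∧ EssentialFor G H f p a)))

/-- `C` is a connected component of the subgraph of `G` induced on `A`. -/
def IsCompOf (G : SimpleGraph V) (A C : Set V) : Prop :=
  C ⊆ A ∧ C.Nonempty ∧ (G.induce C).Connected ∧
  ∀ C' : Set V, C ⊆ C' → C' ⊆ A → (G.induce C').Connected → C' = C

/-- One reconfiguration step that changes (the label of) a vertex of `A` only. -/
def ModelStepWithin (G : SimpleGraph V) (H : SimpleGraph W) (A : Set V) (f g : V → W) : Prop :=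
  IsModel G H f ∧ IsModel G H g ∧ ∃ v ∈ A, f v ≠ g v ∧ ∀ u : V, u ≠ v → f u = g u

/-- `g` is reachable from `f` by reconfiguration steps changing only vertices of `A`. -/
def ReachWithin (G : SimpleGraph V) (H : SimpleGraph W) (A : Set V) (f g : V → W) : Prop :=
  Relation.ReflTransGen (ModelStepWithin G H A) f g

/-- `f` is a leaf-crucial model: some crucial vertex is an interior vertex in a leaf
block of its branch set. -/
def LeafCrucialModel (G : SimpleGraph V) (H : SimpleGraph W) (f : V → W) : Prop :=
  ∃ (v : V) (L : Set V), IsLeafBlockOf G (f ⁻¹' {f v}) L ∧ v ∈ L ∧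
    ¬ IsCutVertexOf G (f ⁻¹' {f v}) v ∧ IsCrucial G H f v

/-- `f` is a leaf-`b`-crucial model: some `b`-crucial vertex is an interior vertex in a
leaf block of its branch set. -/
def LeafBCrucialModel (G : SimpleGraph V) (H : SimpleGraph W) (f : V → W) (b : W) : Prop :=
  ∃ (v : V) (L : Set V), IsLeafBlockOf G (f ⁻¹' {f v}) L ∧ v ∈ L ∧
    ¬ IsCutVertexOf G (f ⁻¹' {f v}) v ∧ IsBCrucial G H f v b

/-- `f` hits a leaf-crucial model on relabeling `A`. -/
def HitsLeafCrucial (G : SimpleGraph V) (H : SimpleGraph W) (A : Set V) (f : V → W) : Prop :=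
  ∀ g : V → W, ReachWithin G H A f g →
    ∃ h : V → W, ReachWithin G H A g h ∧ LeafCrucialModel G H h

/-- `f` hits a leaf-`b`-crucial model on relabeling `A`. -/
def HitsLeafBCrucial (G : SimpleGraph V) (H : SimpleGraph W) (A : Set V) (f : V → W)
    (b : W) : Prop :=
  ∀ g : V → W, ReachWithin G H A f g →
    ∃ h : V → W, ReachWithin G H A g h ∧ LeafBCrucialModel G H h b

end Defs

/-- `K` is a union of connected components of the subgraph of `G` induced on `A`. -/
def AdjClosedIn {V : Type*} (G : SimpleGraph V) (A K : Set V) : Prop :=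
  K ⊆ A ∧ ∀ p ∈ K, ∀ q ∈ A, G.Adj p q → q ∈ K

section Connectivity

variable {V : Type*} {G : SimpleGraph V}

theorem preconnected_induce_iff_adjClosedIn {A : Set V} :
    (G.induce A).Preconnected ↔ ∀ K, AdjClosedIn G A K → K.Nonempty → K = A := by
  constructor
  · rintro h K ⟨hKA, hK⟩ ⟨p, hp⟩
    refine hKA.antisymm fun q hq => ?_
    have hr := (reachable_iff_reflTransGen _ _).1 (h ⟨p, hKA hp⟩ ⟨q, hq⟩)
    suffices ∀ r : A, Relation.ReflTransGen (G.induce A).Adj ⟨p, hKA hp⟩ r → (r : V) ∈ K from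
      this _ hr
    intro r hr
    induction hr with
    | refl => exact hp
    | tail _ hadj ih => exact hK _ ih _ (Subtype.coe_prop _) hadj
  · intro h u w
    have hK := h {q | ∃ hq : q ∈ A, (G.induce A).Reachable u ⟨q, hq⟩}
      ⟨fun q hq => hq.1, ?_⟩ ⟨u, u.2, Reachable.refl _⟩
    · obtain ⟨_, hw⟩ := hK.symm.subset w.2
      exact hw
    · rintro p ⟨hp, hpr⟩ q hq hpq
      have hadj : (G.induce A).Adj ⟨p, hp⟩ ⟨q, hq⟩ := hpq
      exact ⟨hq, hpr.trans hadj.reachable⟩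

theorem AdjClosedIn.compl {A K : Set V} (h : AdjClosedIn G A K) : AdjClosedIn G A (A \ K) :=
  ⟨Set.sdiff_subset, fun p hp q hq hpq => ⟨hq, fun hqK => hp.2 (h.2 q hqK p hp.1 hpq.symm)⟩⟩

theorem isCutVertexOf_iff {A : Set V} {v : V} :
    IsCutVertexOf G A v ↔ v ∈ A ∧ ¬ (G.induce (A \ {v})).Preconnected := by
  simp only [IsCutVertexOf, Preconnected, not_forall]

/-- If `D` is attached to the rest of `A` only through `y`, then removing from `A` a part of `D`
that keeps `A` connected also keeps `insert y D` connected. -/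
theorem preconnected_insert_diff {A D S : Set V} {y : V} (hyA : y ∈ A)
    (hD : AdjClosedIn G (A \ {y}) D) (hS : S ⊆ D) (hz : ∃ z ∈ A, z ≠ y ∧ z ∉ D)
    (h : (G.induce (A \ S)).Preconnected) : (G.induce (insert y D \ S)).Preconnected := by
  rw [preconnected_induce_iff_adjClosedIn] at h ⊢
  obtain ⟨hDA, hDc⟩ := hD
  have hyD : y ∉ D := fun hy => (hDA hy).2 rfl
  rintro K ⟨hKL, hK⟩ hne
  by_cases hyK : y ∈ K
  · have hall := h (K ∪ (A \ D)) ⟨?_, ?_⟩ (hne.mono Set.subset_union_left)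
    · refine hKL.antisymm ?_
      rintro q ⟨rfl | hq, hqS⟩
      · exact hyK
      · have : q ∈ K ∪ (A \ D) := hall ▸ ⟨(hDA hq).1, hqS⟩
        exact this.resolve_right fun h => h.2 hq
    · rintro q (hq | hq)
      · rcases hKL hq with ⟨rfl | hqD, hqS⟩
        · exact ⟨hyA, hqS⟩
        · exact ⟨(hDA hqD).1, hqS⟩
      · exact ⟨hq.1, fun hqS => hq.2 (hS hqS)⟩
    · intro p hp q hq hpq
      by_cases hqD : q ∈ D
      · left
        rcases hp with hp | hp
        · exact hK p hp q ⟨Or.inr hqD, hq.2⟩ hpq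
        · by_cases hpy : p = y
          · subst hpy
            exact hK p hyK q ⟨Or.inr hqD, hq.2⟩ hpq
          · exact absurd (hDc q hqD p ⟨hp.1, hpy⟩ hpq.symm) hp.2
      · exact Or.inr ⟨hq.1, hqD⟩
  · have hKD : K ⊆ D := fun q hq => (hKL hq).1.resolve_left fun hqy => hyK (hqy ▸ hq)
    have hall := h K ⟨fun q hq => ⟨(hDA (hKD hq)).1, (hKL hq).2⟩, ?_⟩ hne
    · exact absurd (hall ▸ ⟨hyA, fun hyS => hyD (hS hyS)⟩) hyK
    · intro p hp q hq hpq
      refine hK p hp q ⟨?_, hq.2⟩ hpq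
      by_cases hqy : q = y
      · exact Or.inl hqy
      · exact Or.inr (hDc p (hKD hp) q ⟨hq.1, hqy⟩ hpq)

/-- Behind a vertex `x` separating `D` from the rest of a connected set `A` there is a leaf block
of `A` all of whose vertices but one are interior and separated from the rest of `A`. -/
theorem exists_leafBlock [Finite V] {A D : Set V} {x : V} (hA : (G.induce A).Preconnected)
    (hxA : x ∈ A) (hD : AdjClosedIn G (A \ {x}) D) (hne : D.Nonempty)
    (hz : ∃ z ∈ A, z ≠ x ∧ z ∉ D) :
    ∃ y E, y ∈ A ∧ AdjClosedIn G (A \ {y}) E ∧ E.Nonempty ∧ (∃ z ∈ A, z ≠ y ∧ z ∉ E) ∧ E ⊆ D ∧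
      IsLeafBlockOf G A (insert y E) ∧ ∀ v ∈ E, ¬ IsCutVertexOf G A v := by
  let P : Set V → Prop := fun E => ∃ y, y ∈ A ∧ AdjClosedIn G (A \ {y}) E ∧ E.Nonempty ∧
    (∃ z ∈ A, z ≠ y ∧ z ∉ E) ∧ E ⊆ D
  obtain ⟨E, ⟨y, hyA, hE, hEne, hEz, hED⟩, hmin⟩ :
      ∃ E, P E ∧ ∀ F, F ⊂ E → ¬ P F := by
    obtain ⟨E, hE, hmin⟩ := wellFounded_lt.has_min {E : Set V | P E}
      ⟨D, x, hxA, hD, hne, hz, subset_rfl⟩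
    exact ⟨E, hE, fun F hF hPF => hmin F hPF hF⟩
  have hyE : y ∉ E := fun hy => (hE.1 hy).2 rfl
  have key : ∀ v ∈ E, ∀ K, AdjClosedIn G (A \ {v}) K → K.Nonempty → y ∉ K → False := by
    intro v hv K hK hKne hyK
    have hKE : K ⊆ E := by
      by_contra hnot
      obtain ⟨z, hzK, hzE⟩ := Set.not_subset.1 hnot
      have hall := preconnected_induce_iff_adjClosedIn.1 hA (K \ E) ⟨fun q hq => (hK.1 hq.1).1, ?_⟩
        ⟨z, hzK, hzE⟩
      · exact hyK (hall.symm.subset hyA).1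
      · intro p hp q hq hpq
        have hqE : q ∉ E := fun hqE =>
          hp.2 (hE.2 q hqE p ⟨(hK.1 hp.1).1, fun hpy => hyK (hpy ▸ hp.1)⟩ hpq.symm)
        exact ⟨hK.2 p hp.1 q ⟨hq, fun hqv => hqE (hqv ▸ hv)⟩ hpq, hqE⟩
    refine hmin K ((Set.ssubset_iff_of_subset hKE).2 ⟨v, hv, fun hvK => (hK.1 hvK).2 rfl⟩)
      ⟨v, (hE.1 hv).1, hK, hKne, ⟨y, hyA, fun hyv => hyE (hyv ▸ hv), hyK⟩, hKE.trans hED⟩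
  have hconn : ∀ v ∈ E, (G.induce (A \ {v})).Preconnected := by
    intro v hv
    rw [preconnected_induce_iff_adjClosedIn]
    intro K hK hKne
    by_contra hKA
    by_cases hyK : y ∈ K
    · refine key v hv _ hK.compl ?_ fun h => h.2 hyK
      rw [Set.sdiff_nonempty]
      exact fun h => hKA (hK.1.antisymm h)
    · exact key v hv K hK hKne hyK
  have hnocut : ∀ v ∈ E, ¬ IsCutVertexOf G A v := fun v hv h =>
    (isCutVertexOf_iff.1 h).2 (hconn v hv)
  refine ⟨y, E, hyA, hE, hEne, hEz, hED, ⟨⟨?_, Set.insert_nonempty _ _, ?_, ?_, ?_⟩, ?_⟩, hnocut⟩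
  · exact Set.insert_subset hyA fun q hq => (hE.1 hq).1
  · have := preconnected_insert_diff hyA hE (Set.empty_subset E) hEz
      (by rwa [Set.sdiff_empty])
    rw [Set.sdiff_empty] at this
    exact (connected_iff _).2 ⟨this, ⟨⟨y, Set.mem_insert _ _⟩⟩⟩
  · intro v hv
    obtain ⟨rfl | hvE, hc⟩ := isCutVertexOf_iff.1 hv
    · refine hc ?_
      rw [Set.insert_sdiff_of_mem _ (Set.mem_singleton _), Set.sdiff_singleton_eq_self hyE,
        preconnected_induce_iff_adjClosedIn]
      intro K hK hKne
      by_contra hKE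
      obtain ⟨z, hzA, hzy, hzE⟩ := hEz
      refine hmin K (hK.1.ssubset_of_ne hKE) ⟨v, hyA, ⟨hK.1.trans hE.1, fun p hp q hq hpq => ?_⟩,
        hKne, ⟨z, hzA, hzy, fun h => hzE (hK.1 h)⟩, hK.1.trans hED⟩
      exact hK.2 p hp q (hE.2 p (hK.1 hp) q hq hpq) hpq
    · exact hc <| preconnected_insert_diff hyA hE (Set.singleton_subset_iff.2 hvE) hEz (hconn v hvE)
  · intro B hLB hBA _ hB
    refine Set.Subset.antisymm (fun z hzB => ?_) hLB
    by_contra hzL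
    rw [Set.mem_insert_iff, not_or] at hzL
    refine hB y (isCutVertexOf_iff.2 ⟨hLB (Set.mem_insert _ _), fun h => hzL.2 ?_⟩)
    refine (preconnected_induce_iff_adjClosedIn.1 h E ⟨fun q hq => ⟨hLB (Or.inr hq), (hE.1 hq).2⟩,
      fun p hp q hq hpq => hE.2 p hp q ⟨hBA hq.1, hq.2⟩ hpq⟩ hEne).symm.subset ⟨hzB, hzL.1⟩
  · have hy : ∀ v ∈ insert y E, IsCutVertexOf G A v → v = y := fun v hv hc =>
      hv.resolve_right fun hvE => hnocut v hvE hc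
    intro v w hv hw hcv hcw
    rw [hy v hv hcv, hy w hw hcw]

/-- In a 2-connected graph, a set of vertices attached to the rest of `A` through a single vertex
has a neighbour outside `A`. -/
theorem KConnected.exists_adj_notMem (h2 : KConnected G 2) {A E : Set V} {y : V}
    (hE : AdjClosedIn G (A \ {y}) E) (hne : E.Nonempty) (hz : ∃ z ∈ A, z ≠ y ∧ z ∉ E) :
    ∃ v ∈ E, ∃ u ∉ A, G.Adj v u := by
  by_contra! hno
  obtain ⟨v, hv⟩ := hne
  obtain ⟨z, -, hzy, hzE⟩ := hz
  refine h2 {y} (Set.finite_singleton y) (by simp) ⟨⟨v, (hE.1 hv).2⟩, ⟨z, hzy⟩, fun hr => ?_⟩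
  have : ∀ r : ({y}ᶜ : Set V),
      Relation.ReflTransGen (G.induce {y}ᶜ).Adj ⟨v, (hE.1 hv).2⟩ r → (r : V) ∈ E := by
    intro r hr
    induction hr with
    | refl => exact hv
    | @tail p q _ hadj ih =>
      have hpq : G.Adj p q := hadj
      by_cases hqA : (q : V) ∈ A
      · exact hE.2 p ih q ⟨hqA, q.2⟩ hpq
      · exact absurd hpq (hno p ih q hqA)
  exact hzE (this _ ((reachable_iff_reflTransGen _ _).1 hr))

theorem IsCompOf.adjClosedIn {A C : Set V} (hC : IsCompOf G A C) : AdjClosedIn G A C := by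
  obtain ⟨hCA, hne, hconn, hmax⟩ := hC
  refine ⟨hCA, fun p hp q hq hpq => ?_⟩
  rw [← hmax (insert q C) (Set.subset_insert _ _) (Set.insert_subset hq hCA) ?_]
  · exact Set.mem_insert _ _
  refine (connected_iff _).2 ⟨preconnected_induce_iff_adjClosedIn.2 fun K hK hKne => ?_, ⟨⟨q, Or.inl rfl⟩⟩⟩
  have hKC : K ∩ C = C := by
    refine preconnected_induce_iff_adjClosedIn.1 hconn.preconnected _ ⟨Set.inter_subset_right, ?_⟩ ?_
    · exact fun r hr s hs hrs => ⟨hK.2 r hr.1 s (Or.inr hs) hrs, hs⟩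
    · obtain ⟨r, hr⟩ := hKne
      rcases hK.1 hr with rfl | hrC
      · exact ⟨p, hK.2 r hr p (Or.inr hp) hpq.symm, hp⟩
      · exact ⟨r, hr, hrC⟩
  have hCK : C ⊆ K := Set.inter_eq_right.1 hKC
  exact hK.1.antisymm (Set.insert_subset (hK.2 p (hCK hp) q (Or.inl rfl) hpq) hCK)

theorem exists_adj_of_preconnected {A : Set V} (hA : (G.induce A).Preconnected) {v x : V}
    (hv : v ∈ A) (hx : x ∈ A) (hxv : x ≠ v) : ∃ w ∈ A, G.Adj v w := by
  by_contra! hno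
  have := preconnected_induce_iff_adjClosedIn.1 hA {v} ⟨Set.singleton_subset_iff.2 hv, ?_⟩ ⟨v, rfl⟩
  · exact hxv (this.symm.subset hx)
  · rintro p rfl q hq hpq
    exact absurd hpq (hno q hq)

end Connectivity

section Reconfiguration

variable {V W : Type*} {G : SimpleGraph V} {H : SimpleGraph W}

/-- Moving `v` to the branch set of a neighbour yields a model, provided that the old branch set
remains connected and `v` is essential for no label but possibly the new one. -/
theorem IsModel.update [DecidableEq V] {f : V → W} (hf : IsModel G H f) {v u x : V} {c : W}
    (hvc : f v ≠ c) (hvu : G.Adj v u) (huc : f u = c) (hx : f x = f v) (hxv : x ≠ v)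
    (hcut : ¬ IsCutVertexOf G (f ⁻¹' {f v}) v)
    (hess : ∀ e, e ≠ c → ¬ EssentialFor G H f v e) :
    IsModel G H (Function.update f v c) := by
  have hold : (G.induce (f ⁻¹' {f v} \ {v})).Preconnected := by
    rw [isCutVertexOf_iff, not_and_not_right] at hcut
    exact hcut rfl
  have hedge : ∀ e, H.Adj (f v) e → ∃ p q, G.Adj p q ∧ Function.update f v c p = f v ∧
      Function.update f v c q = e := by
    intro e he
    by_cases hec : e = c
    · obtain ⟨w, hw, hvw⟩ := exists_adj_of_preconnected (hf.1 (f v)).2.preconnected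
        (v := v) (x := x) rfl hx hxv
      exact ⟨w, v, hvw.symm, by rwa [Function.update_of_ne hvw.ne'], by simp [hec]⟩
    · have := hess e hec
      rw [EssentialFor, not_and] at this
      have := this he
      push Not at this
      obtain ⟨p, q, hpq, hp, hq, hpv⟩ := this
      have hqv : q ≠ v := fun h => he.ne (by rw [← hq, h])
      exact ⟨p, q, hpq, by rwa [Function.update_of_ne hpv], by rwa [Function.update_of_ne hqv]⟩
  refine ⟨fun i => ?_, fun i j hij => ?_⟩
  · by_cases hic : i = c
    · subst hic
      have hset : Function.update f v i ⁻¹' {i} = insert v (f ⁻¹' {i}) := by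
        ext w
        by_cases hw : w = v
        · simp [hw]
        · simp [hw]
      rw [hset]
      refine ⟨Set.insert_nonempty _ _, (connected_iff _).2 ⟨?_, ⟨⟨v, Or.inl rfl⟩⟩⟩⟩
      rw [preconnected_induce_iff_adjClosedIn]
      intro K hK hKne
      have hsub : f ⁻¹' {i} ⊆ K := by
        rw [← Set.inter_eq_right]
        refine preconnected_induce_iff_adjClosedIn.1 (hf.1 i).2.preconnected _ ⟨Set.inter_subset_right, ?_⟩ ?_
        · exact fun r hr s hs hrs => ⟨hK.2 r hr.1 s (Or.inr hs) hrs, hs⟩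
        · obtain ⟨r, hr⟩ := hKne
          rcases hK.1 hr with rfl | hri
          · exact ⟨u, hK.2 r hr u (Or.inr huc) hvu, huc⟩
          · exact ⟨r, hr, hri⟩
      exact hK.1.antisymm (Set.insert_subset (hK.2 u (hsub huc) v (Or.inl rfl) hvu.symm) hsub)
    · by_cases hiv : i = f v
      · subst hiv
        have hset : Function.update f v c ⁻¹' {f v} = f ⁻¹' {f v} \ {v} := by
          ext w
          by_cases hw : w = v
          · simp [hw, Ne.symm hvc]
          · simp [hw]
        rw [hset]
        exact ⟨⟨x, hx, hxv⟩, (connected_iff _).2 ⟨hold, ⟨⟨x, hx, hxv⟩⟩⟩⟩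
      · have hset : Function.update f v c ⁻¹' {i} = f ⁻¹' {i} := by
          ext w
          by_cases hw : w = v
          · simp [hw, Ne.symm hic, Ne.symm hiv]
          · simp [hw]
        rw [hset]
        exact hf.1 i
  · by_cases hi : i = f v
    · exact hi ▸ hedge j (hi ▸ hij)
    · by_cases hj : j = f v
      · obtain ⟨p, q, hpq, hp, hq⟩ := hedge i (hj ▸ hij.symm)
        exact ⟨q, p, hpq.symm, hq, hj ▸ hp⟩
      · obtain ⟨p, q, hpq, hp, hq⟩ := hf.2 hij
        refine ⟨p, q, hpq, ?_, ?_⟩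
        · rwa [Function.update_of_ne]
          rintro rfl
          exact hi hp.symm
        · rwa [Function.update_of_ne]
          rintro rfl
          exact hj hq.symm

theorem ReachWithin.symm {A : Set V} {f g : V → W} (h : ReachWithin G H A f g) :
    ReachWithin G H A g f := by
  induction h with
  | refl => exact .refl
  | tail _ hstep ih =>
    obtain ⟨hf, hg, v, hv, hne, heq⟩ := hstep
    exact .head ⟨hg, hf, v, hv, hne.symm, fun u hu => (heq u hu).symm⟩ ih

/-- An interior vertex of a leaf block with a neighbour outside its branch set can be relabelled,
and to `b` if it has a neighbour labelled `b`. -/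
theorem exists_label_of_not_crucial {g : V → W} (hg : IsModel G H g) {v u : V} {b : W}
    (hvu : G.Adj v u) (huv : g u ≠ g v) (hvb : g v ≠ b) (hnc : ¬ IsCrucial G H g v)
    (hnb : ¬ IsBCrucial G H g v b) :
    ∃ c t, g v ≠ c ∧ G.Adj v t ∧ g t = c ∧ (∀ e, e ≠ c → ¬ EssentialFor G H g v e) ∧
      ((∃ t, G.Adj v t ∧ g t = b) → c = b) := by
  by_cases hb : ∃ t, G.Adj v t ∧ g t = b
  · obtain ⟨t, hvt, htb⟩ := hb
    exact ⟨b, t, hvb, hvt, htb,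
      fun e he hess => hnb ⟨⟨t, hvt, htb⟩, e, hess.1.ne', he, hess⟩, fun _ => rfl⟩
  · by_cases hess : ∃ d, EssentialFor G H g v d
    · obtain ⟨d, hd⟩ := hess
      obtain ⟨p, q, hpq, hp, hq⟩ := hg.2 hd.1
      obtain rfl := hd.2 p q hpq hp hq
      exact ⟨d, q, hd.1.ne, hpq, hq, fun e he h => hnc ⟨e, d, he, h, hd⟩, fun h => absurd h hb⟩
    · push Not at hess
      exact ⟨g u, u, huv.symm, hvu, rfl, fun e _ => hess e, fun h => absurd h hb⟩

end Reconfiguration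

/-- in a 2-connected `G` with `H`-model `f`, `ab ∈ E(H)`, a cut vertex `x`
of `G(f,a)`, and a component `C` of `G(f,a) ∖ {x}` containing a vertex with a neighbour
in `G(f,b)`, such that `f` hits neither a leaf-crucial nor a leaf-`b`-crucial model on
relabeling `C`, `f` reconfigures to a model `g` changing exactly the vertices of `C`
and giving `x` a neighbour in `G(g,b)`. -/
theorem stmt16 {V W : Type} [Fintype V] (G : SimpleGraph V) (H : SimpleGraph W)
    (h2 : KConnected G 2) (f : V → W) (hf : IsModel G H f) (a b : W)
    (hab : H.Adj a b) (x : V) (hxa : f x = a)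
    (hcut : IsCutVertexOf G (f ⁻¹' {a}) x)
    (C : Set V) (hC : IsCompOf G ((f ⁻¹' {a}) \ {x}) C)
    (hCb : ∃ v ∈ C, ∃ u : V, G.Adj v u ∧ f u = b)
    (hnc : ¬ HitsLeafCrucial G H C f)
    (hnb : ¬ HitsLeafBCrucial G H C f b) :
    ∃ g : V → W, Relation.ReflTransGen (ModelStep G H) f g ∧
      (∀ v ∈ C, g v ≠ f v) ∧ (∀ u : V, u ∉ C → g u = f u) ∧
      ∃ w : V, G.Adj x w ∧ g w = b := by
  classical
  have hreach : ∀ g, ReachWithin G H C f g → ¬ LeafCrucialModel G H g := fun g hg hl =>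
    hnc fun k hk => ⟨g, hk.symm.trans hg, hl⟩
  have hreachb : ∀ g, ReachWithin G H C f g → ¬ LeafBCrucialModel G H g b := fun g hg hl =>
    hnb fun k hk => ⟨g, hk.symm.trans hg, hl⟩
  have hCcl := hC.adjClosedIn
  have hxC : x ∉ C := fun h => (hCcl.1 h).2 rfl
  have hCa : ∀ v ∈ C, f v = a := fun v hv => (hCcl.1 hv).1
  obtain ⟨z, hza, hzx, hzC⟩ : ∃ z, f z = a ∧ z ≠ x ∧ z ∉ C := by
    by_contra! hno
    have hCeq : C = f ⁻¹' {a} \ {x} := hCcl.1.antisymm fun z hz => hno z hz.1 hz.2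
    refine (isCutVertexOf_iff.1 hcut).2 ?_
    rw [← hCeq]
    exact hC.2.2.1.preconnected
  suffices main : ∀ (n : ℕ) (g : V → W), (C ∩ g ⁻¹' {a}).ncard = n → ReachWithin G H C f g →
      Relation.ReflTransGen (ModelStep G H) f g → IsModel G H g → (∀ u, u ∉ C → g u = f u) →
      (∃ w ∈ insert x C, g w = a ∧ ∃ u, G.Adj w u ∧ g u = b) →
      ∃ g : V → W, Relation.ReflTransGen (ModelStep G H) f g ∧
        (∀ v ∈ C, g v ≠ f v) ∧ (∀ u : V, u ∉ C → g u = f u) ∧ ∃ w : V, G.Adj x w ∧ g w = b by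
    obtain ⟨w, hw, hwb⟩ := hCb
    exact main _ f rfl .refl .refl hf (fun _ _ => rfl) ⟨w, Or.inr hw, hCa w hw, hwb⟩
  intro n
  induction n using Nat.strong_induction_on with
  | _ n ih =>
    intro g hn hCg hfg hg hout hwb
    by_cases hemp : ∃ v ∈ C, g v = a
    · obtain ⟨v₀, hv₀C, hv₀⟩ := hemp
      have hxg : g x = a := (hout x hxC).trans hxa
      have hzg : g z = a := (hout z hzC).trans hza
      have hsub : g ⁻¹' {a} ⊆ f ⁻¹' {a} := by
        intro u hu
        by_cases huC : u ∈ C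
        · exact hCa u huC
        · exact (hout u huC).symm.trans hu
      have hDcl : AdjClosedIn G (g ⁻¹' {a} \ {x}) (C ∩ g ⁻¹' {a}) :=
        ⟨fun u hu => ⟨hu.2, (hCcl.1 hu.1).2⟩,
          fun p hp q hq hpq => ⟨hCcl.2 p hp.1 q ⟨hsub hq.1, hq.2⟩ hpq, hq.1⟩⟩
      obtain ⟨y, E, -, hE, hEne, hEz, hED, hleaf, hnocut⟩ :=
        exists_leafBlock (hg.1 a).2.preconnected hxg hDcl ⟨v₀, hv₀C, hv₀⟩
          ⟨z, hzg, hzx, fun h => hzC h.1⟩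
      obtain ⟨v, hvE, u, hu, hvu⟩ := h2.exists_adj_notMem hE hEne hEz
      obtain ⟨hvC, hva⟩ := hED hvE
      have hva : g v = a := hva
      have hxv : x ≠ v := fun h => hxC (h ▸ hvC)
      have hcutv : ¬ IsCutVertexOf G (g ⁻¹' {g v}) v := by
        rw [hva]
        exact hnocut v hvE
      have hleafv : IsLeafBlockOf G (g ⁻¹' {g v}) (insert y E) := by
        rwa [hva]
      obtain ⟨c, t, hvc, hvt, htc, hess, hcb⟩ := exists_label_of_not_crucial hg (b := b) hvu
        (fun h => hu (h.trans hva)) (hva ▸ hab.ne)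
        (fun h => hreach g hCg ⟨v, _, hleafv, Or.inr hvE, hcutv, h⟩)
        (fun h => hreachb g hCg ⟨v, _, hleafv, Or.inr hvE, hcutv, h⟩)
      have hmodel := hg.update hvc hvt htc (hxg.trans hva.symm) hxv hcutv hess
      have hdiff : g v ≠ Function.update g v c v := by simpa using hvc
      have hsame : ∀ w, w ≠ v → g w = Function.update g v c w := fun w hw =>
        (Function.update_of_ne hw _ _).symm
      refine ih _ ?_ (Function.update g v c) rfl
        (hCg.tail ⟨hg, hmodel, v, hvC, hdiff, hsame⟩)
        (hfg.tail ⟨hg, hmodel, v, hdiff, hsame⟩) hmodel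
        (fun w hw => (hsame w fun h => hw (h ▸ hvC)).symm.trans (hout w hw)) ?_
      · rw [← hn]
        refine Set.ncard_lt_ncard ((Set.ssubset_iff_of_subset ?_).2 ⟨v, ⟨hvC, hva⟩, ?_⟩)
          (Set.toFinite _)
        · rintro w ⟨hwC, hwa⟩
          refine ⟨hwC, ?_⟩
          by_cases hwv : w = v
          · exact hwv ▸ hva
          · exact (hsame w hwv).trans hwa
        · rintro ⟨-, h⟩
          exact hdiff (hva.trans (Eq.symm h))
      · by_cases hb : ∃ t, G.Adj v t ∧ g t = b
        · obtain ⟨w, hwa, hvw⟩ := exists_adj_of_preconnected (hg.1 a).2.preconnected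
            (v := v) (x := x) hva hxg hxv
          refine ⟨w, ?_, (hsame w hvw.ne').symm.trans hwa, v, hvw.symm, by simp [hcb hb]⟩
          by_cases hwx : w = x
          · exact Or.inl hwx
          · exact Or.inr (hCcl.2 v hvC w ⟨hsub hwa, hwx⟩ hvw)
        · obtain ⟨w, hwC, hwa, s, hws, hsb⟩ := hwb
          have hwv : w ≠ v := fun h => hb ⟨s, h ▸ hws, hsb⟩
          have hsv : s ≠ v := fun h => hab.ne (hva.symm.trans (h ▸ hsb))
          exact ⟨w, hwC, (hsame w hwv).symm.trans hwa, s, hws, (hsame s hsv).symm.trans hsb⟩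
    · push Not at hemp
      refine ⟨g, hfg, fun v hv => hCa v hv ▸ hemp v hv, hout, ?_⟩
      obtain ⟨w, rfl | hwC, hwa, hw⟩ := hwb
      · exact hw
      · exact absurd hwa (hemp w hwC)
end

section
/- Given a 2-connected graph G and a K_3-model f of G, any branch set of f containing at least two vertices contains no crucial vertex. -/
open SimpleGraph

/-- A set of vertices closed under adjacency contains every vertex reachable from one of
its members. -/
theorem SimpleGraph.Reachable.mem_of_adj_closed {V : Type*} {G : SimpleGraph V} {u w : V}
    (h : G.Reachable u w) {s : Set V} (hu : u ∈ s)
    (hs : ∀ x y, G.Adj x y → x ∈ s → y ∈ s) : w ∈ s := by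
  obtain ⟨p⟩ := h
  induction p with
  | nil => exact hu
  | cons hadj _ ih => exact ih (hs _ _ hadj hu)

/-- in a 2-connected graph with a `K₃`-model, any branch set with at least
two vertices contains no crucial vertex. -/
theorem stmt17 {V : Type} [Fintype V] (G : SimpleGraph V) (h2 : KConnected G 2)
    (f : V → Fin 3) (hf : IsModel G (⊤ : SimpleGraph (Fin 3)) f)
    (a : Fin 3) (ha : 2 ≤ (f ⁻¹' {a}).ncard) :
    ∀ v : V, f v = a → ¬ IsCrucial G (⊤ : SimpleGraph (Fin 3)) f v := by
  rintro v hva ⟨b, c, hbc, ⟨hab, hb⟩, ⟨hac, hc⟩⟩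
  obtain ⟨u, hu, huv⟩ := Set.exists_ne_of_one_lt_ncard (s := f ⁻¹' {a}) ha v
  obtain ⟨w, hw⟩ := (hf.1 b).1
  simp only [Set.mem_preimage, Set.mem_singleton_iff] at hu hw
  rw [top_adj] at hab hac
  have hwv : w ≠ v := by
    rintro rfl
    exact hab hw
  refine h2 {v} (Set.finite_singleton v) (by simp) ⟨⟨u, huv⟩, ⟨w, hwv⟩, fun hr => ?_⟩
  have hlabel := hr.mem_of_adj_closed (s := {x | f x = a}) hu fun x y hxy hx => by
    by_contra hy
    have hxv : (x : V) ≠ v := x.2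
    have hxa : f x = f v := hx.trans hva.symm
    have hy' : f y = b ∨ f y = c := by
      simp only [Set.mem_ofPred_eq] at hx hy
      omega
    exact hy'.elim (fun h => hxv (hb x y hxy hxa h)) (fun h => hxv (hc x y hxy hxa h))
  exact hab (hva.trans (hlabel.symm.trans hw))
end

section
/- Suppose G is a 3-connected graph with G ∈ host(K_3), and G' is formed from G by splitting a vertex v into vertices x and y; that is, G' is obtained by deleting v, adding two adjacent vertices x and y, distributing each neighbour of v in G as a neighbour of exactly one of x or y, with both x and y having degree at least 3 in G'. Then G' ∈ host(K_3). -/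
open SimpleGraph

/-- The graph obtained from `G` by splitting the vertex `v` into two adjacent vertices
`x := Sum.inl v` and `y := Sum.inr ()`: every neighbour `u` of `v` becomes a neighbour of
exactly one of `x` (if `u ∈ N`) or `y` (if `u ∉ N`), and all other adjacencies of `G`
are kept. -/
def splitGraph {V : Type} (G : SimpleGraph V) (v : V) (N : Set V) :
    SimpleGraph (V ⊕ Unit) :=
  SimpleGraph.fromRel (fun p q =>
    match p, q with
    | .inl u, .inl w => (u ≠ v ∧ w ≠ v ∧ G.Adj u w) ∨ (u = v ∧ G.Adj v w ∧ w ∈ N)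
    | .inl u, .inr _ => u = v ∨ (G.Adj v u ∧ u ∉ N)
    | _, _ => False)

section Connectivity

variable {V W : Type*} {G : SimpleGraph V} {H : SimpleGraph W}

/-- `S` is nonempty and every predicate that is constant along the edges inside `S` is
constant on `S`. -/
def IndConn (H : SimpleGraph W) (S : Set W) : Prop :=
  S.Nonempty ∧ ∀ p : W → Prop, (∀ a ∈ S, ∀ b ∈ S, H.Adj a b → p a → p b) →
    ∀ a ∈ S, ∀ b ∈ S, p a → p b

/-- After deleting any two vertices, every predicate that is constant along edges is
constant. -/
def NoTwoCut (H : SimpleGraph W) : Prop :=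
  ∀ (z w : W) (p : W → Prop),
    (∀ a b, a ≠ z → a ≠ w → b ≠ z → b ≠ w → H.Adj a b → p a → p b) →
    ∀ a b, a ≠ z → a ≠ w → b ≠ z → b ≠ w → p a → p b

lemma imp_of_reachable_induce {S : Set W} {p : W → Prop}
    (hp : ∀ a ∈ S, ∀ b ∈ S, H.Adj a b → p a → p b) {a b : S}
    (hab : (H.induce S).Reachable a b) : p a → p b := by
  obtain ⟨q⟩ := hab
  induction q with
  | nil => exact id
  | cons h _ ih => exact fun ha => ih (hp _ (Subtype.coe_prop _) _ (Subtype.coe_prop _) h ha)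

lemma induce_connected_iff_indConn {S : Set W} :
    (H.induce S).Connected ↔ IndConn H S := by
  constructor
  · intro h
    obtain ⟨s⟩ := h.nonempty
    exact ⟨⟨s, s.2⟩, fun p hp a ha b hb =>
      imp_of_reachable_induce hp (h.preconnected ⟨a, ha⟩ ⟨b, hb⟩)⟩
  · rintro ⟨⟨s, hs⟩, h⟩
    have : Nonempty S := ⟨⟨s, hs⟩⟩
    refine ⟨fun a b => ?_⟩
    obtain ⟨_, hr⟩ := h (fun t => ∃ ht : t ∈ S, (H.induce S).Reachable a ⟨t, ht⟩)
      (fun c hc d hd hcd ⟨_, hr⟩ => ⟨hd, hr.trans (SimpleGraph.Adj.reachable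
        (G := H.induce S) (u := ⟨c, hc⟩) (v := ⟨d, hd⟩) hcd)⟩)
      a a.2 b b.2 ⟨a.2, SimpleGraph.Reachable.refl _⟩
    exact hr

lemma noTwoCut_of_kConnected (h : KConnected G 3) : NoTwoCut G := by
  intro z w p hp a b haz haw hbz hbw
  have hcard : ({z, w} : Set V).ncard < 3 :=
    lt_of_le_of_lt (Set.ncard_insert_le _ _) (by simp)
  have hr := h {z, w} (Set.toFinite _) hcard
  simp only [IsCutSet, not_exists, not_not] at hr
  have ha : a ∈ ({z, w} : Set V)ᶜ := by simp [haz, haw]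
  have hb : b ∈ ({z, w} : Set V)ᶜ := by simp [hbz, hbw]
  refine imp_of_reachable_induce (p := p) ?_ (hr ⟨a, ha⟩ ⟨b, hb⟩)
  intro c hc d hd hcd
  simp only [Set.mem_compl_iff, Set.mem_insert_iff, Set.mem_singleton_iff, not_or] at hc hd
  exact hp c d hc.1 hc.2 hd.1 hd.2 hcd

lemma IndConn.singleton (d : W) : IndConn H {d} := by
  refine ⟨⟨d, rfl⟩, ?_⟩
  rintro p - a rfl b rfl
  exact id

lemma IndConn.insert {S : Set W} (hS : IndConn H S) {d u : W} (hu : u ∈ S)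
    (hdu : H.Adj d u) : IndConn H (insert d S) := by
  refine ⟨⟨d, Or.inl rfl⟩, fun p hp => ?_⟩
  have hS' := hS.2 p (fun a ha b hb => hp a (Or.inr ha) b (Or.inr hb))
  have h1 := hp d (Or.inl rfl) u (Or.inr hu) hdu
  have h2 := hp u (Or.inr hu) d (Or.inl rfl) hdu.symm
  rintro a (rfl | ha) b (rfl | hb) hpa
  · exact hpa
  · exact hS' u hu b hb (h1 hpa)
  · exact h2 (hS' a ha u hu hpa)
  · exact hS' a ha b hb hpa

lemma IndConn.exists_adj {S : Set W} (hS : IndConn H S) {p : W → Prop} {a b : W}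
    (ha : a ∈ S) (hb : b ∈ S) (hpa : p a) (hpb : ¬ p b) :
    ∃ s ∈ S, ∃ t ∈ S, H.Adj s t ∧ p s ∧ ¬ p t := by
  by_contra! hcon
  exact hpb (hS.2 p hcon a ha b hb hpa)

/-- Removing a part attached at a single vertex keeps a set connected. -/
lemma IndConn.diff_pendant {A K : Set W} (hA : IndConn H A) {z : W} (hz : z ∈ A \ K)
    (hK : ∀ a ∈ K, ∀ b ∈ A \ K, H.Adj a b → b = z) : IndConn H (A \ K) := by
  classical
  refine ⟨⟨z, hz⟩, fun p hp a ha b hb hpa => ?_⟩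
  have key := hA.2 (fun t => if t ∈ K then p z else p t) ?_ a ha.1 b hb.1
  · simpa [ha.2, hb.2, hpa] using key
  · intro c hc d hd hcd
    by_cases hcK : c ∈ K <;> by_cases hdK : d ∈ K <;> simp only [hcK, hdK, if_true, if_false]
    · exact id
    · rw [hK c hcK d ⟨hd, hdK⟩ hcd]; exact id
    · rw [hK d hdK c ⟨hc, hcK⟩ hcd.symm]; exact id
    · exact hp c ⟨hc, hcK⟩ d ⟨hd, hdK⟩ hcd

/-- A part `K` of a connected set `A` attached at a single vertex contains a vertex whose
removal keeps `A` connected and which has a neighbour outside `A` other than `w`. -/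
lemma exists_removable_of_pendant [Finite W] (hH : NoTwoCut H) {A : Set W}
    (hA : IndConn H A) {w r : W} (hw : w ∉ A) (hr : r ∉ A) (hrw : r ≠ w) (K : Set W)
    (hKA : K ⊆ A) (hne : K.Nonempty) (z : W) (hz : z ∈ A \ K)
    (hK : ∀ a ∈ K, ∀ b ∈ A \ K, H.Adj a b → b = z) :
    ∃ d ∈ K, IndConn H (A \ {d}) ∧ ∃ u, u ∉ A ∧ u ≠ w ∧ H.Adj d u := by
  induction hn : K.ncard using Nat.strong_induction_on generalizing K z with
  | _ n ih =>
    obtain ⟨k, hk⟩ := hne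
    obtain ⟨d, u, hd, hu, huz, huw, hdu⟩ :
        ∃ d u, d ∈ K ∧ u ∉ K ∧ u ≠ z ∧ u ≠ w ∧ H.Adj d u := by
      by_contra! hcon
      refine hr (hKA (hH z w (· ∈ K) ?_ k r ?_ ?_ ?_ hrw hk))
      · intro a b _ _ hbz hbw hab ha
        by_contra hb
        exact hcon a b ha hb hbz hbw hab
      · rintro rfl; exact hz.2 hk
      · rintro rfl; exact hw (hKA hk)
      · rintro rfl; exact hr hz.1
    have huA : u ∉ A := fun h => huz (hK d hd u ⟨h, hu⟩ hdu)
    have hzd : z ≠ d := by rintro rfl; exact hz.2 hd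
    by_cases hc : IndConn H (A \ {d})
    · exact ⟨d, hd, hc, u, huA, huw, hdu⟩
    have hrest := hA.diff_pendant hz hK
    obtain ⟨p, hp, t, ht, hpt⟩ : ∃ p : W → Prop,
        (∀ a ∈ A \ {d}, ∀ b ∈ A \ {d}, H.Adj a b → (p a ↔ p b)) ∧
        ∃ t ∈ A \ {d}, ¬ (p t ↔ p z) := by
      by_contra! hcon
      refine hc ⟨⟨z, hz.1, hzd⟩, fun p hp a ha b hb hpa => ?_⟩
      have h := hcon p (fun a ha b hb hab => ⟨hp a ha b hb hab, hp b hb a ha hab.symm⟩)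
      exact (h b hb).2 ((h a ha).1 hpa)
    let T : Set W := {t | t ∈ A \ {d} ∧ ¬ (p t ↔ p z)}
    have hTK : T ⊆ K := by
      rintro s ⟨hs, hps⟩
      by_contra hsK
      have hloc : ∀ a ∈ A \ K, ∀ b ∈ A \ K, H.Adj a b → (p a ↔ p b) :=
        fun a ha b hb => hp a ⟨ha.1, fun h => ha.2 (h ▸ hd)⟩ b ⟨hb.1, fun h => hb.2 (h ▸ hd)⟩
      have hc2 := hrest.2 p (fun a ha b hb hab => (hloc a ha b hb hab).1)
      exact hps ⟨hc2 s ⟨hs.1, hsK⟩ z hz, hc2 z hz s ⟨hs.1, hsK⟩⟩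
    have hlt : T.ncard < n := by
      rw [← hn]
      exact Set.ncard_lt_ncard ⟨hTK, fun h => (h hd).1.2 rfl⟩ (Set.toFinite _)
    obtain ⟨e, he, h⟩ := ih T.ncard hlt T (hTK.trans hKA) ⟨t, ht, hpt⟩ d
      ⟨hKA hd, fun h => h.1.2 rfl⟩ (by
        rintro a ⟨ha, hpa⟩ b ⟨hb, hbT⟩ hab
        by_contra hbd
        have hb' : b ∈ A \ {d} := ⟨hb, hbd⟩
        exact hbT ⟨hb', by rwa [← hp a ha b hb' hab]⟩) rfl
    exact ⟨e, hTK he, h⟩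

/-- If `x` cannot be taken away from `A` (keeping `A` connected and in touch with `C`), then
some other vertex can, and that vertex has a neighbour outside `A` other than `w`. -/
lemma exists_removable_ne [Finite W] (hH : NoTwoCut H) {A C : Set W} (hA : IndConn H A)
    {x t w r : W} (hx : x ∈ A) (ht : t ∈ A) (htx : t ≠ x)
    (hAC : ∃ s ∈ A, ∃ c ∈ C, H.Adj s c)
    (hstuck : ¬ (IndConn H (A \ {x}) ∧ ∃ s ∈ A \ {x}, ∃ c ∈ C, H.Adj s c))
    (hw : w ∉ A) (hr : r ∉ A) (hrw : r ≠ w) :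
    ∃ d ∈ A, d ≠ x ∧ IndConn H (A \ {d}) ∧ (∃ s ∈ A \ {d}, ∃ c ∈ C, H.Adj s c) ∧
      ∃ u, u ∉ A ∧ u ≠ w ∧ H.Adj d u := by
  have main := exists_removable_of_pendant hH hA hw hr hrw
  obtain ⟨s, hs, c, hc, hsc⟩ := hAC
  by_cases hcut : IndConn H (A \ {x})
  · have hsx : s = x := by
      by_contra hne
      exact hstuck ⟨hcut, s, ⟨hs, hne⟩, c, hc, hsc⟩
    subst hsx
    obtain ⟨d, hd, hd', hu⟩ := main (A \ {s}) Set.sdiff_subset ⟨t, ht, htx⟩ s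
      ⟨hx, fun h => h.2 rfl⟩ (by
        rintro a - b ⟨hb, hb'⟩ -
        by_contra hne
        exact hb' ⟨hb, hne⟩)
    exact ⟨d, hd.1, hd.2, hd', ⟨s, ⟨hs, Ne.symm hd.2⟩, c, hc, hsc⟩, hu⟩
  · obtain ⟨p, hp, a, ha, b, hb, hpa, hpb⟩ : ∃ p : W → Prop,
        (∀ a ∈ A \ {x}, ∀ b ∈ A \ {x}, H.Adj a b → p a → p b) ∧
        ∃ a ∈ A \ {x}, ∃ b ∈ A \ {x}, p a ∧ ¬ p b := by
      by_contra! hcon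
      exact hcut ⟨⟨t, ht, htx⟩, hcon⟩
    obtain ⟨d, hd, hd', hdu⟩ := main {t | t ∈ A \ {x} ∧ p t} (fun _ h => h.1.1) ⟨a, ha, hpa⟩ x
      ⟨hx, fun h => h.1.2 rfl⟩ (by
        rintro a ⟨ha, hpa⟩ b ⟨hb, hbT⟩ hab
        by_contra hbx
        exact hbT ⟨⟨hb, hbx⟩, hp a ha b ⟨hb, hbx⟩ hab hpa⟩)
    obtain ⟨e, he, he', heu⟩ := main {t | t ∈ A \ {x} ∧ ¬ p t} (fun _ h => h.1.1) ⟨b, hb, hpb⟩ x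
      ⟨hx, fun h => h.1.2 rfl⟩ (by
        rintro a ⟨ha, hpa⟩ b ⟨hb, hbT⟩ hab
        by_contra hbx
        exact hbT ⟨⟨hb, hbx⟩, fun h => hpa (hp b ⟨hb, hbx⟩ a ha hab.symm h)⟩)
    by_cases hsd : s = d
    · refine ⟨e, he.1.1, he.1.2, he', ⟨s, ⟨hs, ?_⟩, c, hc, hsc⟩, heu⟩
      rintro rfl
      exact he.2 (hsd ▸ hd.2)
    · exact ⟨d, hd.1.1, hd.1.2, hd', ⟨s, ⟨hs, hsd⟩, c, hc, hsc⟩, hdu⟩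

end Connectivity

section Models

variable {W L : Type*} {H : SimpleGraph W}

lemma isModel_top_iff {f : W → L} :
    IsModel H (⊤ : SimpleGraph L) f ↔ (∀ i, IndConn H {t | f t = i}) ∧
      ∀ i j, i ≠ j → ∃ s t, H.Adj s t ∧ f s = i ∧ f t = j := by
  have hset : ∀ i, f ⁻¹' {i} = {t | f t = i} := fun _ => rfl
  simp only [IsModel, induce_connected_iff_indConn, SimpleGraph.top_adj, hset]
  exact and_congr_left fun _ => forall_congr' fun i => ⟨And.right, fun h => ⟨h.1, h⟩⟩

lemma ModelStep.symm {K : SimpleGraph L} {f g : W → L} (h : ModelStep H K f g) :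
    ModelStep H K g f := by
  obtain ⟨hf, hg, d, hd, hne⟩ := h
  exact ⟨hg, hf, d, hd.symm, fun u hu => (hne u hu).symm⟩

lemma reflTransGen_modelStep_symm {K : SimpleGraph L} {f g : W → L}
    (h : Relation.ReflTransGen (ModelStep H K) f g) :
    Relation.ReflTransGen (ModelStep H K) g f := by
  induction h with
  | refl => exact .refl
  | tail _ h ih => exact .head h.symm ih

variable [DecidableEq W]

lemma isModel_update {f : W → L} (hf : IsModel H ⊤ f) {d u : W} (hdu : H.Adj d u)
    (hne : f u ≠ f d) (hA : IndConn H ({t | f t = f d} \ {d}))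
    (hC : ∀ c, c ≠ f d → c ≠ f u → ∃ s t, s ≠ d ∧ H.Adj s t ∧ f s = f d ∧ f t = c) :
    IsModel H ⊤ (Function.update f d (f u)) := by
  rw [isModel_top_iff] at hf ⊢
  obtain ⟨hconn, hedge⟩ := hf
  constructor
  · intro i
    by_cases hid : i = f d
    · subst hid
      convert hA using 1
      ext t
      by_cases htd : t = d
      · simp [htd, hne]
      · simp [htd]
    · by_cases hiu : i = f u
      · subst hiu
        convert (hconn (f u)).insert (d := d) (u := u) rfl hdu using 1
        ext t
        by_cases htd : t = d <;> simp [htd]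
      · convert hconn i using 1
        ext t
        by_cases htd : t = d
        · simp [htd, Ne.symm hid, Ne.symm hiu]
        · simp [htd]
  · have e : ∀ j, j ≠ f d → ∃ s t, H.Adj s t ∧
        Function.update f d (f u) s = f d ∧ Function.update f d (f u) t = j := by
      intro j hj
      by_cases hju : j = f u
      · subst hju
        obtain ⟨s, hs⟩ := hA.1
        obtain ⟨a, ha, b, hb, hab, rfl, hbd⟩ := (hconn (f d)).exists_adj (p := (· = d))
          (a := d) (b := s) rfl hs.1 rfl hs.2
        refine ⟨b, a, hab.symm, ?_, by simp⟩
        rw [Function.update_of_ne hbd]; exact hb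
      · obtain ⟨s, t, hsd, hst, hs, ht⟩ := hC j hj hju
        refine ⟨s, t, hst, by rw [Function.update_of_ne hsd, hs], ?_⟩
        rw [Function.update_of_ne, ht]
        rintro rfl
        exact hj ht.symm
    intro i j hij
    by_cases hi : i = f d
    · exact hi ▸ e j (hi ▸ hij.symm)
    by_cases hj : j = f d
    · obtain ⟨s, t, hst, hs, ht⟩ := e i hi
      exact ⟨t, s, hst.symm, ht, by rw [hs, hj]⟩
    obtain ⟨s, t, hst, hs, ht⟩ := hedge i j hij
    refine ⟨s, t, hst, ?_, ?_⟩
    · rw [Function.update_of_ne, hs]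
      rintro rfl
      exact hi hs.symm
    · rw [Function.update_of_ne, ht]
      rintro rfl
      exact hj ht.symm

lemma modelStep_update {f : W → L} (hf : IsModel H ⊤ f) {d u : W} (hdu : H.Adj d u)
    (hne : f u ≠ f d) (hA : IndConn H ({t | f t = f d} \ {d}))
    (hC : ∀ c, c ≠ f d → c ≠ f u → ∃ s t, s ≠ d ∧ H.Adj s t ∧ f s = f d ∧ f t = c) :
    ModelStep H ⊤ f (Function.update f d (f u)) :=
  ⟨hf, isModel_update hf hdu hne hA hC, d, by simpa using hne.symm,
    fun t ht => by simp [ht]⟩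

end Models

section Gather

variable {W : Type*} [Finite W] [DecidableEq W] {H : SimpleGraph W}

lemma exists_third_label {a b : Fin 3} (h : a ≠ b) :
    ∃ c, c ≠ a ∧ c ≠ b ∧ ∀ i, i ≠ a → i ≠ b → i = c := by
  revert a b
  decide

/-- Either the adjacent vertices `x` and `y` can be given the same label, or a vertex other
than `x` can be moved out of the branch set of `x` into the branch set of a vertex `≠ w`. -/
lemma exists_merge_or_shrink (hH : NoTwoCut H) {x y : W} (hxy : H.Adj x y) {f : W → Fin 3}
    (hf : IsModel H ⊤ f) (hne : f x ≠ f y) {t w : W} (ht : f t = f x) (htx : t ≠ x)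
    (hw : f w ≠ f x) :
    (∃ g, ModelStep H ⊤ f g ∧ g x = g y) ∨
    ∃ d u, d ≠ x ∧ f d = f x ∧ u ≠ w ∧ f u ≠ f x ∧
      ModelStep H ⊤ f (Function.update f d (f u)) := by
  obtain ⟨c, hcx, hcy, hc⟩ := exists_third_label hne
  have hf' := isModel_top_iff.1 hf
  by_cases hstuck : IndConn H ({s | f s = f x} \ {x}) ∧
      ∃ s ∈ {s | f s = f x} \ {x}, ∃ r ∈ {s | f s = c}, H.Adj s r
  · left
    obtain ⟨hconn, s, hs, r, hr, hsr⟩ := hstuck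
    refine ⟨_, modelStep_update hf hxy hne.symm hconn fun i hi hi' => ?_, ?_⟩
    · exact ⟨s, r, hs.2, hsr, hs.1, by rw [hc i hi hi']; exact hr⟩
    · simp [hxy.ne']
  · right
    obtain ⟨r, hr, hrw⟩ : ∃ r, f r ≠ f x ∧ r ≠ w := by
      by_cases hwy : w = y
      · obtain ⟨r, hr⟩ := (hf'.1 c).1
        refine ⟨r, fun h => hcx (hr.symm.trans h), ?_⟩
        rintro rfl
        exact hcy (hwy ▸ hr.symm)
      · exact ⟨y, hne.symm, Ne.symm hwy⟩
    obtain ⟨s, s', hss, hs, hs'⟩ := hf'.2 (f x) c hcx.symm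
    obtain ⟨d, hd, hdx, hconn, ⟨a, ha, b, hb, hab⟩, u, huA, huw, hdu⟩ :=
      exists_removable_ne hH (C := {s | f s = c}) (hf'.1 (f x)) (x := x) rfl ht htx
        ⟨s, hs, s', hs', hss⟩ hstuck hw hr hrw
    have hd : f d = f x := hd
    rw [← hd] at hconn
    by_cases huc : f u = c
    · refine ⟨d, u, hdx, hd, huw, huA, modelStep_update hf hdu ?_ hconn fun i hi hi' => ?_⟩
      · rw [hd]; exact huA
      · refine ⟨x, y, hdx.symm, hxy, hd.symm, ?_⟩
        by_contra hiy
        exact hi' (by rw [huc]; exact hc i (hd ▸ hi) (Ne.symm hiy))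
    · refine ⟨d, u, hdx, hd, huw, huA, modelStep_update hf hdu ?_ hconn fun i hi hi' => ?_⟩
      · rw [hd]; exact huA
      · have huy : f u = f y := by
          by_contra huy
          exact huc (hc _ huA huy)
        refine ⟨a, b, ha.2, hab, by rw [hd]; exact ha.1, ?_⟩
        rw [hc i (hd ▸ hi) (huy ▸ hi')]; exact hb

lemma ncard_fiber_update_lt {L : Type*} {f : W → L} {d : W} {a b : L} (hd : f d = a)
    (hb : b ≠ a) :
    {t | Function.update f d b t = a}.ncard < {t | f t = a}.ncard := by
  refine Set.ncard_lt_ncard ⟨fun t ht => ?_, fun h => ?_⟩ (Set.toFinite _)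
  · have htd : t ≠ d := by
      rintro rfl
      exact hb (by simpa using ht)
    simpa [htd] using ht
  · have := h (show d ∈ {t | f t = a} from hd)
    exact hb (by simpa using this)

lemma exists_merge_or_singleton (hH : NoTwoCut H) {x y : W} (hxy : H.Adj x y)
    {f : W → Fin 3} (hf : IsModel H ⊤ f) (hne : f x ≠ f y) :
    ∃ g, Relation.ReflTransGen (ModelStep H ⊤) f g ∧ IsModel H ⊤ g ∧
      (g x = g y ∨ g x ≠ g y ∧ ∀ t, g t = g x → t = x) := by
  induction hn : {t | f t = f x}.ncard using Nat.strong_induction_on generalizing f with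
  | _ n ih =>
    by_cases hsing : ∀ t, f t = f x → t = x
    · exact ⟨f, .refl, hf, .inr ⟨hne, hsing⟩⟩
    push Not at hsing
    obtain ⟨t, ht, htx⟩ := hsing
    obtain ⟨g, hg, hgxy⟩ | ⟨d, u, hdx, hd, -, hux, hstep⟩ :=
      exists_merge_or_shrink hH hxy hf hne ht htx hne.symm
    · exact ⟨g, .single hg, hg.2.1, .inl hgxy⟩
    · have hdy : y ≠ d := by
        rintro rfl
        exact hne hd.symm
      have hx' : Function.update f d (f u) x = f x := Function.update_of_ne hdx.symm _ _
      have hy' : Function.update f d (f u) y = f y := Function.update_of_ne hdy _ _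
      obtain ⟨g, hg, hg'⟩ := ih _ (hn ▸ ncard_fiber_update_lt hd hux) hstep.2.1
        (by rwa [hx', hy']) (by rw [hx'])
      exact ⟨g, .head hstep hg, hg'⟩

lemma exists_merge_or_singletons (hH : NoTwoCut H) {x y : W} (hxy : H.Adj x y)
    {f : W → Fin 3} (hf : IsModel H ⊤ f) (hne : f x ≠ f y) (hx : ∀ t, f t = f x → t = x) :
    ∃ g, Relation.ReflTransGen (ModelStep H ⊤) f g ∧ IsModel H ⊤ g ∧
      (g x = g y ∨ g x ≠ g y ∧ (∀ t, g t = g x → t = x) ∧ ∀ t, g t = g y → t = y) := by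
  induction hn : {t | f t = f y}.ncard using Nat.strong_induction_on generalizing f with
  | _ n ih =>
    by_cases hsing : ∀ t, f t = f y → t = y
    · exact ⟨f, .refl, hf, .inr ⟨hne, hx, hsing⟩⟩
    push Not at hsing
    obtain ⟨t, ht, hty⟩ := hsing
    obtain ⟨g, hg, hgxy⟩ | ⟨d, u, hdy, hd, hux, huy, hstep⟩ :=
      exists_merge_or_shrink hH hxy.symm hf hne.symm ht hty hne
    · exact ⟨g, .single hg, hg.2.1, .inl hgxy.symm⟩
    · have hdx : x ≠ d := by
        rintro rfl
        exact hne hd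
      have hx' : Function.update f d (f u) x = f x := Function.update_of_ne hdx _ _
      have hy' : Function.update f d (f u) y = f y := Function.update_of_ne hdy.symm _ _
      obtain ⟨g, hg, hg'⟩ := ih _ (hn ▸ ncard_fiber_update_lt hd huy) hstep.2.1
        (by rwa [hx', hy']) (fun s hs => by
          rw [hx'] at hs
          by_cases hsd : s = d
          · subst hsd
            rw [Function.update_self] at hs
            exact absurd (hx u hs) hux
          · rw [Function.update_of_ne hsd] at hs
            exact hx s hs) (by rw [hy'])
      exact ⟨g, .head hstep hg, hg'⟩

end Gather

section Split

variable {V W : Type*} {G : SimpleGraph V} {H : SimpleGraph W}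

/-- `H` arises from `G` by splitting `v` into the adjacent vertices `x` and `y`, and `π`
contracts the edge `xy` back to `v`; both `x` and `y` have degree at least three. -/
structure IsSplit (G : SimpleGraph V) (H : SimpleGraph W) (π : W → V) (v : V) (x y : W) :
    Prop where
  adj : H.Adj x y
  map_left : π x = v
  map_right : π y = v
  eq_or_eq : ∀ a, π a = v → a = x ∨ a = y
  inj : ∀ a b, π a = π b → π a ≠ v → a = b
  surj : Function.Surjective π
  adj_map : ∀ a b, H.Adj a b → π a ≠ π b → G.Adj (π a) (π b)
  adj_lift : ∀ p q, G.Adj p q → ∃ a b, π a = p ∧ π b = q ∧ H.Adj a b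
  deg_left : ∀ w, ∃ u, u ≠ y ∧ u ≠ w ∧ H.Adj x u
  deg_right : ∀ w, ∃ u, u ≠ x ∧ u ≠ w ∧ H.Adj y u

namespace IsSplit

variable {π : W → V} {v : V} {x y : W}

lemma symm (h : IsSplit G H π v x y) : IsSplit G H π v y x where
  adj := h.adj.symm
  map_left := h.map_right
  map_right := h.map_left
  eq_or_eq a ha := (h.eq_or_eq a ha).symm
  inj := h.inj
  surj := h.surj
  adj_map := h.adj_map
  adj_lift := h.adj_lift
  deg_left := h.deg_right
  deg_right := h.deg_left

lemma map_ne (h : IsSplit G H π v x y) {a : W} (hx : a ≠ x) (hy : a ≠ y) : π a ≠ v :=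
  fun ha => (h.eq_or_eq a ha).elim hx hy

lemma map_ne_map (h : IsSplit G H π v x y) {a b : W} (hx : a ≠ x) (hy : a ≠ y)
    (hab : a ≠ b) : π a ≠ π b :=
  fun hπ => hab (h.inj a b hπ (h.map_ne hx hy))

/-- Deleting `x`, `y` and one further vertex leaves a connected graph. -/
lemma imp_off_three (h : IsSplit G H π v x y) (hG : NoTwoCut G) (w : W) (p : W → Prop)
    (hp : ∀ a b, a ≠ x → a ≠ y → a ≠ w → b ≠ x → b ≠ y → b ≠ w → H.Adj a b → p a → p b)
    (a b : W) (hax : a ≠ x) (hay : a ≠ y) (haw : a ≠ w) (hbx : b ≠ x) (hby : b ≠ y)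
    (hbw : b ≠ w) (hpa : p a) : p b := by
  obtain ⟨c, hc, hpc⟩ : ∃ c, π c = π b ∧ p c := by
    refine hG v (π w) (fun u => ∃ c, π c = u ∧ p c) ?_ (π a) (π b)
      (h.map_ne hax hay) (h.map_ne_map hax hay haw) (h.map_ne hbx hby)
      (h.map_ne_map hbx hby hbw) ⟨a, rfl, hpa⟩
    rintro s t hsv hsw htv htw hst ⟨c, rfl, hpc⟩
    obtain ⟨c', d, hc', rfl, hcd⟩ := h.adj_lift _ _ hst
    obtain rfl := h.inj c' c hc' (hc' ▸ hsv)
    refine ⟨d, rfl, hp c' d ?_ ?_ ?_ ?_ ?_ ?_ hcd hpc⟩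
    · rintro rfl; exact hsv h.map_left
    · rintro rfl; exact hsv h.map_right
    · rintro rfl; exact hsw rfl
    · rintro rfl; exact htv h.map_left
    · rintro rfl; exact htv h.map_right
    · rintro rfl; exact htw rfl
  rwa [h.inj b c hc.symm (h.map_ne hbx hby)]

/-- Deleting `x` and one further vertex leaves a connected graph. -/
lemma imp_off_left (h : IsSplit G H π v x y) (hG : NoTwoCut G) (w : W) (p : W → Prop)
    (hp : ∀ a b, a ≠ x → a ≠ w → b ≠ x → b ≠ w → H.Adj a b → p a → p b)
    (a b : W) (hax : a ≠ x) (haw : a ≠ w) (hbx : b ≠ x) (hbw : b ≠ w) (hpa : p a) :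
    p b := by
  have key := h.imp_off_three hG w p
    (fun a b hax _ haw hbx _ hbw => hp a b hax haw hbx hbw)
  obtain ⟨u, hux, huw, hyu⟩ := h.deg_right w
  by_cases hay : a = y
  · subst hay
    by_cases hby : b = a
    · rwa [hby]
    · exact key u b hux hyu.ne' huw hbx hby hbw (hp a u hax haw hux huw hyu hpa)
  · by_cases hby : b = y
    · subst hby
      exact hp u b hux huw hbx hbw hyu.symm (key a u hax hay haw hux hyu.ne' huw hpa)
    · exact key a b hax hay haw hbx hby hbw hpa

lemma noTwoCut (h : IsSplit G H π v x y) (hG : NoTwoCut G) : NoTwoCut H := by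
  intro z w p hp a b haz haw hbz hbw hpa
  have hp' : ∀ a b, a ≠ w → a ≠ z → b ≠ w → b ≠ z → H.Adj a b → p a → p b :=
    fun a b h1 h2 h3 h4 => hp a b h2 h1 h4 h3
  by_cases hzx : z = x
  · subst hzx; exact h.imp_off_left hG w p hp a b haz haw hbz hbw hpa
  by_cases hzy : z = y
  · subst hzy; exact h.symm.imp_off_left hG w p hp a b haz haw hbz hbw hpa
  by_cases hwx : w = x
  · subst hwx; exact h.imp_off_left hG z p hp' a b haw haz hbw hbz hpa
  by_cases hwy : w = y
  · subst hwy; exact h.symm.imp_off_left hG z p hp' a b haw haz hbw hbz hpa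
  have hxy : p x ↔ p y :=
    ⟨hp x y (Ne.symm hzx) (Ne.symm hwx) (Ne.symm hzy) (Ne.symm hwy) h.adj,
      hp y x (Ne.symm hzy) (Ne.symm hwy) (Ne.symm hzx) (Ne.symm hwx) h.adj.symm⟩
  have hπ : ∀ c d, π c = π d → p c → p d := by
    intro c d hcd hpc
    by_cases hcv : π c = v
    · rcases h.eq_or_eq c hcv with rfl | rfl <;>
        rcases h.eq_or_eq d (hcd ▸ hcv) with rfl | rfl <;> tauto
    · rwa [← h.inj c d hcd hcv]
  obtain ⟨c, hc, hpc⟩ : ∃ c, π c = π b ∧ p c := by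
    refine hG (π z) (π w) (fun u => ∃ c, π c = u ∧ p c) ?_ (π a) (π b)
      (h.map_ne_map hzx hzy haz.symm).symm (h.map_ne_map hwx hwy haw.symm).symm
      (h.map_ne_map hzx hzy hbz.symm).symm (h.map_ne_map hwx hwy hbw.symm).symm ⟨a, rfl, hpa⟩
    rintro s t hsz hsw htz htw hst ⟨c, rfl, hpc⟩
    obtain ⟨c', d, hc', rfl, hcd⟩ := h.adj_lift _ _ hst
    refine ⟨d, rfl, hp c' d ?_ ?_ ?_ ?_ hcd (hπ c c' hc'.symm hpc)⟩
    · rintro rfl; exact hsz hc'.symm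
    · rintro rfl; exact hsw hc'.symm
    · rintro rfl; exact htz rfl
    · rintro rfl; exact htw rfl
  exact hπ c b hc hpc

lemma exists_merge_of_singletons [DecidableEq W] (h : IsSplit G H π v x y)
    (hG : NoTwoCut G) {f : W → Fin 3} (hf : IsModel H ⊤ f) (hne : f x ≠ f y)
    (hx : ∀ t, f t = f x → t = x) (hy : ∀ t, f t = f y → t = y) :
    ∃ g, Relation.ReflTransGen (ModelStep H ⊤) f g ∧ IsModel H ⊤ g ∧ g x = g y := by
  obtain ⟨c, hcx, hcy, hc⟩ := exists_third_label hne
  have hfc : ∀ t, t ≠ x → t ≠ y → f t = c := fun t htx hty =>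
    hc _ (fun h => htx (hx t h)) (fun h => hty (hy t h))
  have hfc' : ∀ t, f t = c → t ≠ x ∧ t ≠ y := by
    rintro t rfl
    exact ⟨fun h => hcx (by rw [h]), fun h => hcy (by rw [h])⟩
  obtain ⟨p, hpy, -, hxp⟩ := h.deg_left x
  obtain ⟨q, hqy, hqp, hxq⟩ := h.deg_left p
  obtain ⟨r, hrx, hrp, hyr⟩ := h.deg_right p
  have hpc : f p = c := hfc p hxp.ne' hpy
  have hqc : f q = c := hfc q hxq.ne' hqy
  have hrc : f r = c := hfc r hrx hyr.ne'
  have hstep : ModelStep H ⊤ f (Function.update f p (f x)) := by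
    refine modelStep_update hf hxp.symm (by rw [hpc]; exact hcx.symm) ⟨⟨q, ?_, hqp⟩, ?_⟩ ?_
    · rw [hpc]; exact hqc
    · rw [hpc]
      intro Q hQ a ha b hb
      have ha' := hfc' a ha.1
      have hb' := hfc' b hb.1
      exact h.imp_off_three hG p Q
        (fun a b hax hay hap hbx hby hbp => hQ a ⟨hfc a hax hay, hap⟩ b ⟨hfc b hbx hby, hbp⟩)
        a b ha'.1 ha'.2 ha.2 hb'.1 hb'.2 hb.2
    · intro i hi hi'
      have hiy : i = f y := by
        by_contra hiy
        exact hi (by rw [hpc]; exact hc i hi' hiy)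
      exact ⟨r, y, hrp, hyr.symm, by rw [hrc, hpc], hiy.symm⟩
  set g := Function.update f p (f x) with hg
  have hgp : g p = f x := by simp [hg]
  have hgo : ∀ t, t ≠ p → g t = f t := fun t ht => by simp [hg, ht]
  have hgx : g x = f x := hgo x hxp.ne
  have hgy : g y = f y := hgo y hpy.symm
  obtain ⟨p', hpp', hp'x, hp'y⟩ : ∃ p', H.Adj p p' ∧ p' ≠ x ∧ p' ≠ y := by
    by_contra! hcon
    refine hqp (h.noTwoCut hG x y (· = p) ?_ p q hxp.ne' hpy hxq.ne' hqy rfl)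
    rintro a b - - hbx hby hab rfl
    exact absurd (hcon b hab hbx) hby
  have hstep' : ModelStep H ⊤ g (Function.update g x (g y)) := by
    refine modelStep_update hstep.2.1 h.adj (by rw [hgx, hgy]; exact hne.symm) ?_ ?_
    · convert IndConn.singleton (H := H) p using 1
      ext t
      simp only [Set.mem_sdiff, Set.mem_ofPred_eq, Set.mem_singleton_iff, hgx]
      constructor
      · rintro ⟨h1, h2⟩
        by_contra htp
        exact h2 (hx t (hgo t htp ▸ h1))
      · rintro rfl
        exact ⟨hgp, hxp.ne'⟩
    · intro i hi hi'
      refine ⟨p, p', hxp.ne', hpp', by rw [hgp, hgx], ?_⟩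
      rw [hgo p' hpp'.ne', hfc p' hp'x hp'y]
      exact (hc i (hgx ▸ hi) (hgy ▸ hi')).symm
  refine ⟨_, .tail (.single hstep) hstep', hstep'.2.1, ?_⟩
  simp [h.adj.ne']

lemma exists_merge [Finite W] [DecidableEq W] (h : IsSplit G H π v x y)
    (hG : NoTwoCut G) {f : W → Fin 3} (hf : IsModel H ⊤ f) :
    ∃ g, Relation.ReflTransGen (ModelStep H ⊤) f g ∧ IsModel H ⊤ g ∧ g x = g y := by
  have hH := h.noTwoCut hG
  by_cases hne : f x = f y
  · exact ⟨f, .refl, hf, hne⟩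
  obtain ⟨g, hfg, hg, hgxy | ⟨hgne, hgx⟩⟩ := exists_merge_or_singleton hH h.adj hf hne
  · exact ⟨g, hfg, hg, hgxy⟩
  obtain ⟨k, hgk, hk, hkxy | ⟨hkne, hkx, hky⟩⟩ :=
    exists_merge_or_singletons hH h.adj hg hgne hgx
  · exact ⟨k, hfg.trans hgk, hk, hkxy⟩
  obtain ⟨l, hkl, hl, hlxy⟩ := h.exists_merge_of_singletons hG hk hkne hkx hky
  exact ⟨l, (hfg.trans hgk).trans hkl, hl, hlxy⟩

lemma indConn_preimage_iff (h : IsSplit G H π v x y) {A : Set V} :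
    IndConn H (π ⁻¹' A) ↔ IndConn G A := by
  constructor
  · rintro ⟨⟨a, ha⟩, hA⟩
    refine ⟨⟨π a, ha⟩, fun p hp s hs t ht => ?_⟩
    obtain ⟨s, rfl⟩ := h.surj s
    obtain ⟨t, rfl⟩ := h.surj t
    refine hA (fun c => p (π c)) (fun c hc d hd hcd hpc => ?_) s hs t ht
    by_cases hπ : π c = π d
    · exact hπ ▸ hpc
    · exact hp _ hc _ hd (h.adj_map c d hcd hπ) hpc
  · rintro ⟨⟨a, ha⟩, hA⟩
    obtain ⟨a, rfl⟩ := h.surj a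
    refine ⟨⟨a, ha⟩, fun p hp s hs t ht hps => ?_⟩
    have hπ : ∀ c d, π c ∈ A → π c = π d → p c → p d := by
      intro c d hcA hcd hpc
      by_cases hcv : π c = v
      · have hxA : x ∈ π ⁻¹' A := by simpa [h.map_left, ← hcv] using hcA
        have hyA : y ∈ π ⁻¹' A := by simpa [h.map_right, ← hcv] using hcA
        have h1 := hp x hxA y hyA h.adj
        have h2 := hp y hyA x hxA h.adj.symm
        rcases h.eq_or_eq c hcv with rfl | rfl <;>
          rcases h.eq_or_eq d (hcd ▸ hcv) with rfl | rfl <;> tauto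
      · rwa [← h.inj c d hcd hcv]
    obtain ⟨c, hc, hpc⟩ : ∃ c, π c = π t ∧ p c := by
      refine hA (fun u => ∃ c, π c = u ∧ p c) ?_ (π s) hs (π t) ht ⟨s, rfl, hps⟩
      rintro _ hc u hu hcu ⟨c, rfl, hpc⟩
      obtain ⟨c', d, hc', rfl, hcd⟩ := h.adj_lift _ _ hcu
      exact ⟨d, rfl, hp c' (by rwa [Set.mem_preimage, hc']) d hu hcd
        (hπ c c' hc hc'.symm hpc)⟩
    exact hπ c t (hc ▸ ht) hc hpc

lemma isModel_comp_iff {L : Type*} (h : IsSplit G H π v x y) {f : V → L} :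
    IsModel H ⊤ (f ∘ π) ↔ IsModel G ⊤ f := by
  rw [isModel_top_iff, isModel_top_iff]
  refine and_congr (forall_congr' fun i => h.indConn_preimage_iff (A := {t | f t = i}))
    (forall_congr' fun i => forall_congr' fun j => imp_congr_right fun hij => ?_)
  constructor
  · rintro ⟨s, t, hst, rfl, rfl⟩
    exact ⟨π s, π t, h.adj_map s t hst fun hπ => hij (by simp [hπ]), rfl, rfl⟩
  · rintro ⟨s, t, hst, rfl, rfl⟩
    obtain ⟨a, b, rfl, rfl, hab⟩ := h.adj_lift s t hst
    exact ⟨a, b, hab, rfl, rfl⟩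

lemma exists_eq_comp {L : Type*} (h : IsSplit G H π v x y) {g : W → L} (hg : g x = g y) :
    ∃ f : V → L, g = f ∘ π := by
  refine ⟨fun u => g (Function.surjInv h.surj u), ?_⟩
  funext a
  have ha : π (Function.surjInv h.surj (π a)) = π a := Function.surjInv_eq h.surj _
  set b := Function.surjInv h.surj (π a) with hb
  change g a = g b
  by_cases hav : π a = v
  · rcases h.eq_or_eq a hav with h1 | h1 <;> rcases h.eq_or_eq b (ha ▸ hav) with h2 | h2 <;>
      rw [h1, h2]
    · exact hg
    · exact hg.symm
  · rw [h.inj a b ha.symm hav]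

end IsSplit

end Split

section Lift

variable {V W : Type*} [DecidableEq W] {G : SimpleGraph V} {H : SimpleGraph W}
  {π : W → V} {v : V} {x y : W}

/-- Relabelling an edge `xy`, one endpoint at a time, when the endpoint moved first is in
touch with the new branch set and the other one with the rest of the old branch set. -/
lemma reflTransGen_of_adj_of_adj {L : Type*} (hxy : x ≠ y) {f g : W → L}
    (hf : IsModel H ⊤ f) (hg : IsModel H ⊤ g) (hfxy : f x = f y) (hgxy : g x = g y)
    (hne : f x ≠ g x) (hoff : ∀ t, t ≠ x → t ≠ y → f t = g t) {s t : W}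
    (hs : H.Adj y s) (hsg : g s = f x) (ht : H.Adj x t) (htf : f t = g x) :
    Relation.ReflTransGen (ModelStep H ⊤) f g := by
  have hg' := isModel_top_iff.1 hg
  have hgf : ∀ r, g r = f x → r ≠ x ∧ r ≠ y ∧ f r = f x := by
    intro r hr
    have hrx : r ≠ x := by rintro rfl; exact hne hr.symm
    have hry : r ≠ y := by rintro rfl; exact hne (by rw [hgxy, hr])
    exact ⟨hrx, hry, by rw [hoff r hrx hry, hr]⟩
  have hstep : ModelStep H ⊤ f (Function.update f x (f t)) := by
    refine modelStep_update hf ht (htf ▸ hne.symm) ?_ ?_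
    · convert (hg'.1 (f x)).insert hsg hs using 1
      ext r
      by_cases hrx : r = x
      · subst hrx
        simp [hne.symm, hxy]
      by_cases hry : r = y
      · simp [hry, hfxy, hxy.symm]
      · simp [hrx, hry, hoff r hrx hry]
    · intro i hi hi'
      obtain ⟨r, q, hrq, hr, hq⟩ := hg'.2 (f x) i hi.symm
      refine ⟨r, q, (hgf r hr).1, hrq, (hgf r hr).2.2, ?_⟩
      rw [hoff, hq]
      · rintro rfl; exact hi' (hq ▸ htf.symm)
      · rintro rfl; exact hi' (by rw [← hq, ← hgxy, htf])
  refine .tail (.single hstep) ⟨hstep.2.1, hg, y, ?_, fun r hr => ?_⟩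
  · rw [Function.update_of_ne hxy.symm, ← hfxy, ← hgxy]
    exact hne
  · by_cases hrx : r = x
    · simp [hrx, htf]
    · simp [hrx, hoff r hrx hr]

/-- If `y` sees only `x` in its branch set, it can be moved to the branch set of a
neighbour. -/
lemma modelStep_update_right {L : Type*} (hxy : x ≠ y) {f g : W → L}
    (hf : IsModel H ⊤ f) (hg : IsModel H ⊤ g) (hfxy : f x = f y) (hgxy : g x = g y)
    (hne : f x ≠ g x) (hoff : ∀ t, t ≠ x → t ≠ y → f t = g t) {s t r : W}
    (hs : H.Adj x s) (hsg : g s = f x) (ht : H.Adj x t) (htf : f t = g x)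
    (hr : H.Adj y r) (hrf : f r ≠ f x) (hL : ∀ i, i ≠ f x → i ≠ f r → i = g x) :
    ModelStep H ⊤ f (Function.update f y (f r)) := by
  refine modelStep_update hf hr (hfxy ▸ hrf) ?_ ?_
  · convert ((isModel_top_iff.1 hg).1 (f x)).insert hsg hs using 1
    ext q
    by_cases hqx : q = x
    · subst hqx
      simp [hfxy, hxy]
    by_cases hqy : q = y
    · simp [hqy, ← hgxy, hne.symm, hxy.symm]
    · simp [hqx, hqy, hoff q hqx hqy, hfxy]
  · intro i hi hi'
    exact ⟨x, t, hxy, ht, hfxy, htf.trans (hL i (hfxy ▸ hi) hi').symm⟩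

namespace IsSplit

/-- Two models in which `x` and `y` share a label and which differ only there can be
reconfigured into each other. -/
lemma reflTransGen_of_eq_off (h : IsSplit G H π v x y) {f g : W → Fin 3}
    (hf : IsModel H ⊤ f) (hg : IsModel H ⊤ g) (hfxy : f x = f y) (hgxy : g x = g y)
    (hne : f x ≠ g x) (hoff : ∀ t, t ≠ x → t ≠ y → f t = g t) :
    Relation.ReflTransGen (ModelStep H ⊤) f g := by
  have touch : ∀ {f g : W → Fin 3}, IsModel H ⊤ f → IsModel H ⊤ g → f x = f y →
      g x = g y → f x ≠ g x → (∀ t, t ≠ x → t ≠ y → f t = g t) →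
      ∃ s, g s = f x ∧ (H.Adj x s ∨ H.Adj y s) := by
    intro f g hf hg hfxy hgxy hne hoff
    obtain ⟨s, hs⟩ := ((isModel_top_iff.1 hg).1 (f x)).1
    have hs : g s = f x := hs
    have hsx : s ≠ x := by rintro rfl; exact hne hs.symm
    have hsy : s ≠ y := by rintro rfl; exact hne (by rw [hgxy, hs])
    obtain ⟨a, -, b, hb, hab, ha', hb'⟩ :
        ∃ a ∈ {t | f t = f x}, ∃ b ∈ {t | f t = f x}, H.Adj a b ∧ (a = x ∨ a = y) ∧
          ¬ (b = x ∨ b = y) :=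
      ((isModel_top_iff.1 hf).1 (f x)).exists_adj (p := fun t => t = x ∨ t = y) (a := x)
        (b := s) rfl (by simp [hoff s hsx hsy, hs]) (.inl rfl) (by simp [hsx, hsy])
    rw [not_or] at hb'
    refine ⟨b, (hoff b hb'.1 hb'.2).symm.trans hb, ?_⟩
    rcases ha' with rfl | rfl
    · exact .inl hab
    · exact .inr hab
  have hoff' : ∀ t, t ≠ x → t ≠ y → g t = f t := fun t h1 h2 => (hoff t h1 h2).symm
  -- `y` has all its neighbours other than `x` in the third branch set
  have detour : ∀ {x y : W}, IsSplit G H π v x y → f x = f y → g x = g y → f x ≠ g x →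
      (∀ t, t ≠ x → t ≠ y → f t = g t) → ∀ {s t}, H.Adj x s → g s = f x → H.Adj x t →
      f t = g x → (∀ r, H.Adj y r → g r ≠ f x) → (∀ r, H.Adj y r → f r ≠ g x) →
      Relation.ReflTransGen (ModelStep H ⊤) f g := by
    intro x y h hfxy hgxy hne hoff s t hs hsg ht htf hyA hyB
    obtain ⟨r, hrx, -, hyr⟩ := h.deg_right x
    have hfg : f r = g r := hoff r hrx hyr.ne'
    have hrf : f r ≠ f x := hfg ▸ hyA r hyr
    have hrg : f r ≠ g x := hyB r hyr
    obtain ⟨c, -, -, hc⟩ := exists_third_label hne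
    have hrc := hc _ hrf hrg
    have h1 := modelStep_update_right h.adj.ne hf hg hfxy hgxy hne hoff hs hsg ht htf hyr hrf
      (fun i hi hi' => by
        by_contra hig
        exact hi' (by rw [hrc]; exact hc i hi hig))
    have h2 := modelStep_update_right h.adj.ne hg hf hgxy hfxy hne.symm
      (fun t h1 h2 => (hoff t h1 h2).symm) ht htf hs hsg hyr (hfg ▸ hrg)
      (fun i hi hi' => by
        by_contra hig
        exact hi' (by rw [← hfg, hrc]; exact hc i hig hi))
    refine .head h1 (.head ⟨h1.2.1, h2.2.1, x, ?_, fun t ht => ?_⟩ (.single h2.symm))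
    · simpa [h.adj.ne] using hne
    · by_cases hty : t = y
      · simp [hty, hfg]
      · simp [hty, hoff t ht hty]
  obtain ⟨s, hsg, hs⟩ := touch hf hg hfxy hgxy hne hoff
  obtain ⟨t, htf, ht⟩ := touch hg hf hgxy hfxy hne.symm hoff'
  have hne' : f y ≠ g y := hfxy ▸ hgxy ▸ hne
  have hoffs : ∀ t, t ≠ y → t ≠ x → f t = g t := fun t h1 h2 => hoff t h2 h1
  by_cases hyA : ∃ r, H.Adj y r ∧ g r = f x
  · obtain ⟨r, hyr, hr⟩ := hyA
    by_cases hxB : ∃ q, H.Adj x q ∧ f q = g x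
    · obtain ⟨q, hxq, hq⟩ := hxB
      exact reflTransGen_of_adj_of_adj h.adj.ne hf hg hfxy hgxy hne hoff hyr hr hxq hq
    have hyt : H.Adj y t := ht.resolve_left fun h => hxB ⟨t, h, htf⟩
    by_cases hxA : ∃ q, H.Adj x q ∧ g q = f x
    · obtain ⟨q, hxq, hq⟩ := hxA
      exact reflTransGen_of_adj_of_adj h.adj.ne' hf hg hfxy.symm hgxy.symm hne' hoffs hxq
        (hq.trans hfxy) hyt (htf.trans hgxy)
    · push Not at hxA hxB
      exact detour h.symm hfxy.symm hgxy.symm hne' hoffs hyr (hr.trans hfxy) hyt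
        (htf.trans hgxy) (fun r hr => hfxy ▸ hxA r hr) (fun r hr => hgxy ▸ hxB r hr)
  · have hxs : H.Adj x s := hs.resolve_right fun h => hyA ⟨s, h, hsg⟩
    by_cases hyB : ∃ q, H.Adj y q ∧ f q = g x
    · obtain ⟨q, hyq, hq⟩ := hyB
      exact reflTransGen_of_adj_of_adj h.adj.ne' hf hg hfxy.symm hgxy.symm hne' hoffs hxs
        (hsg.trans hfxy) hyq (hq.trans hgxy)
    · have hxt : H.Adj x t := ht.resolve_right fun h => hyB ⟨t, h, htf⟩
      push Not at hyA hyB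
      exact detour h hfxy hgxy hne hoff hxs hsg hxt htf hyA hyB

lemma reflTransGen_comp (h : IsSplit G H π v x y) {f g : V → Fin 3}
    (hfg : Relation.ReflTransGen (ModelStep G ⊤) f g) :
    Relation.ReflTransGen (ModelStep H ⊤) (f ∘ π) (g ∘ π) := by
  induction hfg with
  | refl => exact .refl
  | @tail k l _ hstep ih =>
    refine ih.trans ?_
    obtain ⟨hk, hl, u, hu, hoff⟩ := hstep
    rw [← h.isModel_comp_iff] at hk hl
    by_cases huv : u = v
    · subst huv
      refine h.reflTransGen_of_eq_off hk hl ?_ ?_ ?_ ?_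
      · simp [h.map_left, h.map_right]
      · simp [h.map_left, h.map_right]
      · simpa [h.map_left] using hu
      · exact fun t htx hty => hoff _ (h.map_ne htx hty)
    · obtain ⟨a, rfl⟩ := h.surj u
      exact .single ⟨hk, hl, a, hu, fun t hta => hoff _ fun hπ =>
        hta (h.inj a t hπ.symm huv).symm⟩

lemma inHost [Finite W] (h : IsSplit G H π v x y) (hG : NoTwoCut G)
    (hhost : InHost G (⊤ : SimpleGraph (Fin 3))) : InHost H (⊤ : SimpleGraph (Fin 3)) := by
  obtain ⟨⟨f₀, hf₀⟩, hconn⟩ := hhost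
  refine ⟨⟨f₀ ∘ π, h.isModel_comp_iff.2 hf₀⟩, fun f g hf hg => ?_⟩
  obtain ⟨f', hff', hf', hfxy⟩ := h.exists_merge hG hf
  obtain ⟨g', hgg', hg', hgxy⟩ := h.exists_merge hG hg
  obtain ⟨k, rfl⟩ := h.exists_eq_comp hfxy
  obtain ⟨l, rfl⟩ := h.exists_eq_comp hgxy
  have hkl := hconn k l (h.isModel_comp_iff.1 hf') (h.isModel_comp_iff.1 hg')
  exact (hff'.trans (h.reflTransGen_comp hkl)).trans (reflTransGen_modelStep_symm hgg')

end IsSplit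

end Lift

section SplitGraph

variable {V : Type} {G : SimpleGraph V} {v : V} {N : Set V}

lemma splitGraph_adj_inl_inl {u w : V} : (splitGraph G v N).Adj (.inl u) (.inl w) ↔
    G.Adj u w ∧ (u = v → w ∈ N) ∧ (w = v → u ∈ N) := by
  by_cases hu : u = v <;> by_cases hw : w = v <;> by_cases huw : u = w <;>
    simp_all [splitGraph, SimpleGraph.fromRel_adj, G.adj_comm]

lemma splitGraph_adj_inl_inr {u : V} : (splitGraph G v N).Adj (.inl u) (.inr ()) ↔
    u = v ∨ G.Adj v u ∧ u ∉ N := by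
  simp [splitGraph, SimpleGraph.fromRel_adj]

lemma exists_adj_ne_ne {W : Type*} [Finite W] {H : SimpleGraph W} {a : W}
    (ha : 3 ≤ (H.neighborSet a).ncard) (b w : W) : ∃ u, u ≠ b ∧ u ≠ w ∧ H.Adj a u := by
  by_contra! hcon
  have hsub : H.neighborSet a ⊆ {b, w} := by
    intro u hu
    by_contra hbw
    rw [Set.mem_insert_iff, Set.mem_singleton_iff, not_or] at hbw
    exact hcon u hbw.1 hbw.2 hu
  have h1 := Set.ncard_le_ncard hsub (Set.toFinite _)
  have h2 : ({b, w} : Set W).ncard ≤ 2 := (Set.ncard_insert_le _ _).trans (by simp)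
  omega

lemma isSplit_splitGraph [Finite V]
    (hdegx : 3 ≤ ((splitGraph G v N).neighborSet (Sum.inl v)).ncard)
    (hdegy : 3 ≤ ((splitGraph G v N).neighborSet (Sum.inr ())).ncard) :
    IsSplit G (splitGraph G v N) (Sum.elim id fun _ => v) v (Sum.inl v) (Sum.inr ()) where
  adj := splitGraph_adj_inl_inr.2 (.inl rfl)
  map_left := rfl
  map_right := rfl
  eq_or_eq := by rintro (a | a) ha <;> simp_all
  inj := by rintro (a | a) (b | b) hab ha <;> simp_all
  surj u := ⟨.inl u, rfl⟩
  adj_map := by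
    rintro (a | a) (b | b) hab hπ
    · exact (splitGraph_adj_inl_inl.1 hab).1
    · exact ((splitGraph_adj_inl_inr.1 hab).resolve_left hπ).1.symm
    · exact ((splitGraph_adj_inl_inr.1 hab.symm).resolve_left (Ne.symm hπ)).1
    · exact absurd rfl hπ
  adj_lift := by
    intro p q hpq
    by_cases hp : p = v
    · subst hp
      by_cases hq : q ∈ N
      · exact ⟨.inl p, .inl q, rfl, rfl,
          splitGraph_adj_inl_inl.2 ⟨hpq, fun _ => hq, fun h => absurd h hpq.ne'⟩⟩
      · exact ⟨.inr (), .inl q, rfl, rfl, (splitGraph_adj_inl_inr.2 (.inr ⟨hpq, hq⟩)).symm⟩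
    · by_cases hq : q = v
      · subst hq
        by_cases hpN : p ∈ N
        · exact ⟨.inl p, .inl q, rfl, rfl,
            splitGraph_adj_inl_inl.2 ⟨hpq, fun h => absurd h hp, fun _ => hpN⟩⟩
        · exact ⟨.inl p, .inr (), rfl, rfl,
            splitGraph_adj_inl_inr.2 (.inr ⟨hpq.symm, hpN⟩)⟩
      · exact ⟨.inl p, .inl q, rfl, rfl,
          splitGraph_adj_inl_inl.2 ⟨hpq, fun h => absurd h hp, fun h => absurd h hq⟩⟩
  deg_left := exists_adj_ne_ne hdegx _
  deg_right := exists_adj_ne_ne hdegy _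

end SplitGraph

/-- if `G` is 3-connected and `G ∈ host(K₃)`, and `G'` is obtained from
`G` by splitting a vertex `v` into adjacent vertices `x` and `y` (each neighbour of `v`
going to exactly one of them, both of degree at least 3), then `G' ∈ host(K₃)`. -/
theorem stmt19 {V : Type} [Fintype V] [DecidableEq V] (G : SimpleGraph V)
    (h3 : KConnected G 3) (hG : InHost G (⊤ : SimpleGraph (Fin 3)))
    (v : V) (N : Set V)
    (hdegx : 3 ≤ ((splitGraph G v N).neighborSet (Sum.inl v)).ncard)
    (hdegy : 3 ≤ ((splitGraph G v N).neighborSet (Sum.inr ())).ncard) :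
    InHost (splitGraph G v N) (⊤ : SimpleGraph (Fin 3)) := by
  exact (isSplit_splitGraph hdegx hdegy).inHost (noTwoCut_of_kConnected h3) hG
end
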